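/- Consider any σ ∈ S_non(1/3) and any ρ ∈ G^*. There is a constant c_G > 0 depending only on G such that, for the product replacement chain started at σ and all large enough n, Pr_σ(⋃_{t=1}^{n²} {‖x_ρ(σ_t)‖_HS ≥ n^{−1/8} + e^{−c_G·t/n}·‖x_ρ(σ_0)‖_HS}) ≤ 1/n³. -/

import Mathlib

open scoped BigOperators
open Filter

attribute [local instance] Classical.propDecidable

noncomputable section

namespace PR

variable (G : Type) [Group G] [Fintype G]

/-- A configuration: an `n`-tuple of elements of `G`. -/
abbrev Config (n : ℕ) := Fin n → G

/-- The set of generating `n`-tuples. -/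
def gens (n : ℕ) : Set (Config G n) :=
  {σ | Subgroup.closure (Set.range σ) = ⊤}

/-- A move of the product replacement chain: an ordered pair of distinct indices
together with a sign (`true` = multiply, `false` = multiply by inverse). -/
abbrev Move (n : ℕ) := {p : Fin n × Fin n // p.1 ≠ p.2} × Bool

/-- Applying a move: replace `σ i` by `σ i * (σ j)^{±1}`. -/
def applyMove {n : ℕ} (σ : Config G n) (m : Move n) : Config G n :=
  Function.update σ m.1.1.1
    (σ m.1.1.1 * (if m.2 then σ m.1.1.2 else (σ m.1.1.2)⁻¹))

/-- One-step transition probability of the product replacement chain. -/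
def step {n : ℕ} (σ σ' : Config G n) : ℝ :=
  ((Finset.univ.filter (fun m : Move n => applyMove G σ m = σ')).card : ℝ) /
    (Fintype.card (Move n) : ℝ)

/-- The law of `σ_t` for the chain started at `σ₀`. -/
def law {n : ℕ} (σ₀ : Config G n) : ℕ → Config G n → ℝ
  | 0 => fun σ' => if σ' = σ₀ then 1 else 0
  | (t + 1) => fun σ' => ∑ τ : Config G n, law σ₀ t τ * step G τ σ'

/-- Probability that `σ_t ∈ E` for the chain started at `σ₀`. -/
def prob {n : ℕ} (σ₀ : Config G n) (t : ℕ) (E : Set (Config G n)) : ℝ :=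
  ∑ τ ∈ Finset.univ.filter (fun τ => τ ∈ E), law G σ₀ t τ

/-- Probability of a trajectory event for the chain started at `σ₀`, over the
time horizon `{0, 1, …, T}`. -/
def pathProb {n : ℕ} (σ₀ : Config G n) (T : ℕ)
    (E : Set (Fin (T + 1) → Config G n)) : ℝ :=
  ∑ p ∈ Finset.univ.filter
      (fun p : Fin (T + 1) → Config G n => p 0 = σ₀ ∧ p ∈ E),
    ∏ t : Fin T, step G (p t.castSucc) (p t.succ)

/-- `n_a(σ)`: the number of sites holding the group element `a`. -/
def nCount {n : ℕ} (σ : Config G n) (a : G) : ℕ :=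
  (Finset.univ.filter (fun i => σ i = a)).card

/-- `n^H_non(σ)`: the number of sites whose element lies outside `H`. -/
def nNon {n : ℕ} (H : Subgroup G) (σ : Config G n) : ℕ :=
  (Finset.univ.filter (fun i => σ i ∉ H)).card

/-- `n^{id}_non(σ)`: the number of sites not holding the identity. -/
def nNonId {n : ℕ} (σ : Config G n) : ℕ :=
  (Finset.univ.filter (fun i => σ i ≠ 1)).card

/-- `S_non(c)`. -/
def SNon (n : ℕ) (c : ℝ) : Set (Config G n) :=
  {σ | σ ∈ gens G n ∧
    ∀ H : Subgroup G, H ≠ ⊤ → c * n ≤ (nNon G H σ : ℝ)}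

/-- The `δ`-typical set `S_*(δ)`. -/
def SAst (n : ℕ) (δ : ℝ) : Set (Config G n) :=
  {σ | σ ∈ gens G n ∧
    Real.sqrt (∑ a : G, ((nCount G σ a : ℝ) / n - 1 / (Fintype.card G : ℝ)) ^ 2) ≤ δ}

/-- `n^{σ₀}_{a,b}(σ)`. -/
def nab {n : ℕ} (σ₀ σ : Config G n) (a b : G) : ℕ :=
  (Finset.univ.filter (fun i => σ₀ i = a ∧ σ i = b)).card

/-- `S_*(σ₀, r)`. -/
def SAstM {n : ℕ} (σ₀ : Config G n) (r : ℝ) : Set (Config G n) :=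
  {σ | σ ∈ gens G n ∧
    ∀ a : G, Real.sqrt (∑ b : G,
      ((nab G σ₀ σ a b : ℝ) / (nCount G σ₀ a : ℝ) - 1 / (Fintype.card G : ℝ)) ^ 2) ≤ r}

/-- The uniform stationary distribution `π` on the set of generating tuples. -/
def statDist (n : ℕ) : Config G n → ℝ := fun σ =>
  if σ ∈ gens G n then
    1 / ((Finset.univ.filter (fun τ : Config G n => τ ∈ gens G n)).card : ℝ)
  else 0

/-- Total-variation distance between two (finitely supported) signed weights,
as the supremum over finite sets `A` of `|p(A) - q(A)|`. -/
def tvDist {α : Type*} (p q : α → ℝ) : ℝ :=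
  sSup {x : ℝ | ∃ A : Finset α, x = |∑ a ∈ A, p a - ∑ a ∈ A, q a|}

/-- `d_σ(t) = max_{A ⊆ S} |P_σ(σ_t ∈ A) - π(A)|`. -/
def dTV {n : ℕ} (σ : Config G n) (t : ℕ) : ℝ :=
  sSup {x : ℝ | ∃ A : Finset (Config G n), ↑A ⊆ gens G n ∧
    x = |∑ τ ∈ A, law G σ t τ - ∑ τ ∈ A, statDist G n τ|}

/-- `max_{σ ∈ S} d_σ(t)`. -/
def dMax (n : ℕ) (t : ℕ) : ℝ :=
  sSup {x : ℝ | ∃ σ ∈ gens G n, x = dTV G σ t}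

end PR

namespace PR

variable (G : Type) [Group G] [Fintype G]

/-- A unitary representation of `G` of dimension `d`, as a monoid homomorphism into the
unitary group of `d × d` complex matrices. -/
abbrev UnitaryRep (d : ℕ) := G →* Matrix.unitaryGroup (Fin d) ℂ

/-- A representation is non-trivial if some group element acts non-trivially. -/
def IsNontrivialRep {d : ℕ} (ρ : UnitaryRep G d) : Prop :=
  ∃ a : G, ((ρ a : Matrix (Fin d) (Fin d) ℂ)) ≠ 1

/-- Irreducibility: the only invariant subspaces are `⊥` and `⊤`. -/
def IsIrreducibleRep {d : ℕ} (ρ : UnitaryRep G d) : Prop :=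
  ∀ W : Submodule ℂ (Fin d → ℂ),
    (∀ a : G, ∀ w ∈ W, ((ρ a : Matrix (Fin d) (Fin d) ℂ)).mulVec w ∈ W) →
    W = ⊥ ∨ W = ⊤

/-- Hilbert–Schmidt norm of a complex matrix. -/
def hsNorm {d : ℕ} (A : Matrix (Fin d) (Fin d) ℂ) : ℝ :=
  Real.sqrt (∑ i : Fin d, ∑ j : Fin d, ‖A i j‖ ^ 2)

/-- Operator norm (`ℓ² → ℓ²`) of a complex matrix. -/
def opNorm {d : ℕ} (A : Matrix (Fin d) (Fin d) ℂ) : ℝ :=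
  ‖LinearMap.toContinuousLinearMap (Matrix.toEuclideanLin A)‖

/-- The Fourier coefficient `x_ρ(σ) = Σ_a (n_a(σ)/n) ρ(a)`. -/
def xCoeff {n d : ℕ} (ρ : UnitaryRep G d) (σ : Config G n) :
    Matrix (Fin d) (Fin d) ℂ :=
  ∑ a : G, (((nCount G σ a : ℝ) / (n : ℝ) : ℝ) : ℂ) • (ρ a : Matrix (Fin d) (Fin d) ℂ)

/-- `X_ρ(σ) = (1/(n−1)) ((x_ρ(σ) + x_ρ(σ)^*)/2 − ((n−1)/n) I)`. -/
def XMat {n d : ℕ} (ρ : UnitaryRep G d) (σ : Config G n) :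
    Matrix (Fin d) (Fin d) ℂ :=
  (((n : ℂ) - 1)⁻¹) •
    ((xCoeff G ρ σ + star (xCoeff G ρ σ)) / 2 - (((n : ℂ) - 1) / (n : ℂ)) • (1 : Matrix (Fin d) (Fin d) ℂ))

/-- The Fourier coefficient `y^{σ_*}_{a,ρ}(σ) = Σ_b (n^{σ_*}_{a,b}(σ)/n_a(σ_*)) ρ(b)`. -/
def yCoeff {n d : ℕ} (ρ : UnitaryRep G d) (σast σ : Config G n) (a : G) :
    Matrix (Fin d) (Fin d) ℂ :=
  ∑ b : G, (((nab G σast σ a b : ℝ) / (nCount G σast a : ℝ) : ℝ) : ℂ) •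
    (ρ b : Matrix (Fin d) (Fin d) ℂ)

end PR

namespace PR

variable {G : Type} [Group G]

/-- The one-step conditional expectation operator of the product replacement chain. -/
def transition {n : ℕ} (f : Config G n → ℝ) (σ : Config G n) : ℝ :=
  (∑ m : Move n, f (applyMove G σ m)) / (Fintype.card (Move n) : ℝ)

theorem sum_move {n : ℕ} (F : Fin n → Fin n → Bool → ℝ) :
    ∑ m : Move n, F m.1.1.1 m.1.1.2 m.2 =
      ∑ i, ∑ j, ∑ b, F i j b - ∑ i, ∑ b, F i i b := by
  have h1 : ∑ m : Move n, F m.1.1.1 m.1.1.2 m.2 =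
      ∑ p ∈ Finset.univ.filter (fun p : Fin n × Fin n => p.1 ≠ p.2), ∑ b, F p.1 p.2 b := by
    rw [Fintype.sum_prod_type]
    symm
    exact Finset.sum_subtype (p := fun p : Fin n × Fin n => p.1 ≠ p.2) _ (by simp)
      (fun p => ∑ b, F p.1 p.2 b)
  have h2 := Finset.sum_filter_add_sum_filter_not (Finset.univ : Finset (Fin n × Fin n))
    (fun p => p.1 ≠ p.2) (fun p => ∑ b, F p.1 p.2 b)
  have h3 : ∑ p ∈ Finset.univ.filter (fun p : Fin n × Fin n => ¬ p.1 ≠ p.2), ∑ b, F p.1 p.2 b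
      = ∑ i, ∑ b, F i i b := by
    rw [Finset.sum_filter, Fintype.sum_prod_type]
    refine Finset.sum_congr rfl fun i _ => ?_
    simp
  rw [h1, ← Fintype.sum_prod_type' (f := fun i j => ∑ b, F i j b), ← h2, h3]
  ring

theorem card_move (n : ℕ) : (Fintype.card (Move n) : ℝ) = 2 * (n * (n - 1)) := by
  have := sum_move (n := n) (fun _ _ _ => 1)
  simp only [Finset.sum_const, Finset.card_univ, Fintype.card_fin, Fintype.card_bool,
    nsmul_eq_mul, mul_one] at this
  rw [this]
  push_cast
  ring

theorem card_move_pos {n : ℕ} (hn : 2 ≤ n) : (0 : ℝ) < Fintype.card (Move n) := by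
  rw [card_move]
  have : (2 : ℝ) ≤ n := by exact_mod_cast hn
  nlinarith

theorem transition_mono {n : ℕ} {f g : Config G n → ℝ} (h : f ≤ g) :
    transition f ≤ transition g := fun σ => by
  unfold transition
  gcongr with m
  exact h _

theorem transition_add {n : ℕ} (f g : Config G n → ℝ) :
    transition (f + g) = transition f + transition g := by
  ext σ
  simp [transition, Finset.sum_add_distrib, add_div]

theorem transition_smul {n : ℕ} (c : ℝ) (f : Config G n → ℝ) :
    transition (c • f) = c • transition f := by
  ext σ
  simp [transition, ← Finset.mul_sum, mul_div_assoc]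

theorem transition_const {n : ℕ} (hn : 2 ≤ n) (c : ℝ) :
    transition (fun _ : Config G n => c) = fun _ => c := by
  ext σ
  have := card_move_pos hn
  unfold transition
  rw [Finset.sum_const, Finset.card_univ, nsmul_eq_mul]
  field_simp

theorem iterate_transition_mono {n : ℕ} (t : ℕ) {f g : Config G n → ℝ} (h : f ≤ g) :
    transition^[t] f ≤ transition^[t] g := by
  induction t generalizing f g with
  | zero => exact h
  | succ t ih => exact ih (transition_mono h)

theorem iterate_transition_add {n : ℕ} (t : ℕ) (f g : Config G n → ℝ) :
    transition^[t] (f + g) = transition^[t] f + transition^[t] g := by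
  induction t generalizing f g with
  | zero => rfl
  | succ t ih => simp only [Function.iterate_succ, Function.comp_apply, transition_add, ih]

theorem iterate_transition_smul {n : ℕ} (t : ℕ) (c : ℝ) (f : Config G n → ℝ) :
    transition^[t] (c • f) = c • transition^[t] f := by
  induction t generalizing f with
  | zero => rfl
  | succ t ih => simp only [Function.iterate_succ, Function.comp_apply, transition_smul, ih]

theorem iterate_transition_const {n : ℕ} (hn : 2 ≤ n) (t : ℕ) (c : ℝ) :
    transition^[t] (fun _ : Config G n => c) = fun _ => c :=
  Function.iterate_fixed (transition_const hn c) t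

theorem iterate_transition_sum {n : ℕ} {ι : Type*} (s : Finset ι) (t : ℕ)
    (f : ι → Config G n → ℝ) :
    transition^[t] (∑ i ∈ s, f i) = ∑ i ∈ s, transition^[t] (f i) := by
  induction s using Finset.induction_on with
  | empty =>
    have := iterate_transition_smul t 0 (0 : Config G n → ℝ)
    simpa using this
  | insert a s ha ih => rw [Finset.sum_insert ha, Finset.sum_insert ha, iterate_transition_add, ih]

theorem step_nonneg {n : ℕ} (σ τ : Config G n) : 0 ≤ step G σ τ := by
  unfold step
  positivity

variable [Fintype G]

theorem sum_step_mul {n : ℕ} (f : Config G n → ℝ) (σ : Config G n) :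
    ∑ τ, step G σ τ * f τ = transition f σ := by
  unfold transition step
  rw [← Finset.sum_fiberwise (Finset.univ : Finset (Move n)) (fun m => applyMove G σ m)
    (fun m => f (applyMove G σ m)), Finset.sum_div]
  refine Finset.sum_congr rfl fun τ _ => ?_
  rw [Finset.sum_congr rfl (g := fun _ => f τ)
    (fun m hm => by rw [(Finset.mem_filter.1 hm).2]), Finset.sum_const, nsmul_eq_mul]
  ring

/-- The expectation of a function of the state at time `t`, as a sum over trajectories. -/
theorem sum_path {n : ℕ} (hn : 2 ≤ n) (T : ℕ) (t : Fin (T + 1)) (f : Config G n → ℝ)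
    (σ : Config G n) :
    ∑ p ∈ Finset.univ.filter (fun p : Fin (T + 1) → Config G n => p 0 = σ),
      (∏ s : Fin T, step G (p s.castSucc) (p s.succ)) * f (p t) = transition^[t] f σ := by
  induction T generalizing σ f with
  | zero =>
    obtain rfl : t = 0 := Fin.fin_one_eq_zero t
    rw [Finset.sum_eq_single (fun _ => σ)]
    · simp
    · intro p hp hne
      refine absurd ?_ hne
      ext1 i
      rw [Fin.fin_one_eq_zero i]
      exact (Finset.mem_filter.1 hp).2
    · simp
  | succ T ih =>
    rw [Finset.sum_filter, ← (Fin.consEquiv (fun _ : Fin (T + 2) => Config G n)).sum_comp,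
      Fintype.sum_prod_type]
    simp only [Fin.consEquiv_apply, Fin.cons_zero]
    rw [Finset.sum_comm]
    simp only [Finset.sum_ite_eq', Finset.mem_univ, if_true, Fin.prod_univ_succ, Fin.cons_succ,
      Fin.castSucc_zero, Fin.cons_zero, ← Fin.succ_castSucc]
    have key : ∀ (t' : Fin (T + 1)) (g : Config G n → ℝ),
        ∑ q : Fin (T + 1) → Config G n, step G σ (q 0) *
          (∏ s : Fin T, step G (q s.castSucc) (q s.succ)) * g (q t') =
        transition (transition^[t'] g) σ := by
      intro t' g
      rw [← sum_step_mul, ← Finset.sum_fiberwise Finset.univ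
        (fun q : Fin (T + 1) → Config G n => q 0)]
      refine Finset.sum_congr rfl fun τ _ => ?_
      rw [← ih t' g τ, Finset.mul_sum]
      refine Finset.sum_congr rfl fun q hq => ?_
      rw [(Finset.mem_filter.1 hq).2]
      ring
    refine Fin.cases ?_ (fun t' => ?_) t
    · have := key 0 (fun _ => f σ)
      simp only [Fin.cons_zero]
      rw [this, iterate_transition_const hn, transition_const hn]
      simp
    · simp only [Fin.cons_succ, Fin.val_succ]
      rw [key t' f, Function.iterate_succ_apply']

/-- Union bound over the times `1, …, T` for a trajectory event. -/
theorem pathProb_le_sum {n : ℕ} (hn : 2 ≤ n) (σ : Config G n) (T : ℕ)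
    (A : ℕ → Set (Config G n)) :
    pathProb G σ T {p | ∃ t : Fin (T + 1), 1 ≤ (t : ℕ) ∧ p t ∈ A t} ≤
      ∑ t ∈ Finset.Icc 1 T, transition^[t] ((A t).indicator 1) σ := by
  have h : ∑ t ∈ Finset.Icc 1 T, transition^[t] ((A t).indicator 1) σ =
      ∑ t ∈ Finset.univ.filter (fun t : Fin (T + 1) => 1 ≤ (t : ℕ)),
        transition^[(t : ℕ)] ((A t).indicator 1) σ := by
    refine Finset.sum_bij' (fun t ht => ⟨t, by have := Finset.mem_Icc.1 ht; omega⟩)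
      (fun t _ => (t : ℕ)) ?_ ?_ ?_ ?_ ?_
    · intro t ht
      simpa using (Finset.mem_Icc.1 ht).1
    · intro t ht
      have := t.isLt
      simp only [Finset.mem_filter, Finset.mem_univ, true_and] at ht
      exact Finset.mem_Icc.2 ⟨ht, by omega⟩
    all_goals simp
  rw [h, Finset.sum_congr rfl fun t _ => (sum_path hn T t _ σ).symm, Finset.sum_comm]
  unfold pathProb
  rw [← Finset.filter_filter, Finset.sum_filter]
  refine Finset.sum_le_sum fun p _ => ?_
  have hp : 0 ≤ ∏ s : Fin T, step G (p s.castSucc) (p s.succ) :=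
    Finset.prod_nonneg fun _ _ => step_nonneg _ _
  have hnn : ∀ t : Fin (T + 1), 0 ≤ (A t).indicator (1 : Config G n → ℝ) (p t) := fun t =>
    Set.indicator_nonneg (fun _ _ => zero_le_one) _
  split_ifs with hE
  · obtain ⟨t, ht, hpt⟩ := hE
    have := Finset.single_le_sum
      (s := Finset.univ.filter (fun t : Fin (T + 1) => 1 ≤ (t : ℕ)))
      (f := fun t : Fin (T + 1) => (∏ s : Fin T, step G (p s.castSucc) (p s.succ)) *
        (A t).indicator (1 : Config G n → ℝ) (p t))
      (fun t _ => mul_nonneg hp (hnn t))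
      (Finset.mem_filter.2 ⟨Finset.mem_univ t, ht⟩)
    simpa [Set.indicator_of_mem hpt] using this
  · exact Finset.sum_nonneg fun t _ => mul_nonneg hp (hnn t)

end PR
namespace PR

theorem sum_comp_update {G : Type*} {n : ℕ} {M : Type*} [AddCommMonoid M] (f : G → M) (σ : Fin n → G)
    (i : Fin n) (v : G) :
    ∑ k, f (Function.update σ i v k) + f (σ i) = ∑ k, f (σ k) + f v := by
  have h1 : ∑ k, f (Function.update σ i v k) = f v + ∑ k ∈ Finset.univ \ {i}, f (σ k) := by
    rw [← Finset.sum_update_of_mem (Finset.mem_univ i) (fun k => f (σ k)) (f v)]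
    exact Finset.sum_congr rfl fun k _ => congrFun (Function.comp_update f σ i v) k
  rw [h1, Finset.sum_eq_sum_sdiff_singleton_add (Finset.mem_univ i) (fun k => f (σ k))]
  abel

variable {G : Type} [Group G]

theorem nNon_update {n : ℕ} (H : Subgroup G) (σ : Config G n) (i : Fin n) (v : G) :
    nNon G H (Function.update σ i v) + (if σ i ∉ H then 1 else 0) =
      nNon G H σ + (if v ∉ H then 1 else 0) := by
  unfold nNon
  rw [Finset.card_filter, Finset.card_filter]
  exact sum_comp_update (fun a => if a ∉ H then 1 else 0) σ i v

theorem mul_sign_mem_iff (H : Subgroup G) (a b : G) (ε : Bool) (hb : b ∈ H) :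
    a * (if ε then b else b⁻¹) ∈ H ↔ a ∈ H :=
  H.mul_mem_cancel_right (by split_ifs <;> simpa using hb)

theorem mul_sign_notMem (H : Subgroup G) (a b : G) (ε : Bool) (ha : a ∈ H) (hb : b ∉ H) :
    a * (if ε then b else b⁻¹) ∉ H := by
  rw [H.mul_mem_cancel_left ha]
  split_ifs <;> simpa using hb

theorem half_pow_nNon_applyMove_le {n : ℕ} (H : Subgroup G) (σ : Config G n) (m : Move n) :
    (1 / 2 : ℝ) ^ nNon G H (applyMove G σ m) ≤ (1 / 2 : ℝ) ^ nNon G H σ *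
      (1 + (if σ m.1.1.2 ∉ H then 1 else 0) * (3 * (if σ m.1.1.1 ∉ H then 1 else 0) - 1) / 2) := by
  have h := nNon_update H σ m.1.1.1 (σ m.1.1.1 * (if m.2 then σ m.1.1.2 else (σ m.1.1.2)⁻¹))
  change nNon G H (applyMove G σ m) + _ = _ at h
  by_cases hj : σ m.1.1.2 ∈ H
  · rw [mul_sign_mem_iff H _ _ _ hj] at h
    have h' : nNon G H (applyMove G σ m) = nNon G H σ := by omega
    simp [h', hj]
  · by_cases hi : σ m.1.1.1 ∈ H
    · have := mul_sign_notMem H _ _ m.2 hi hj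
      rw [if_pos this, if_neg (not_not.2 hi)] at h
      have h' : nNon G H (applyMove G σ m) = nNon G H σ + 1 := by omega
      rw [h', pow_succ]
      simp only [hj, hi, not_true_eq_false, not_false_eq_true, if_true, if_false]
      exact le_of_eq (by ring)
    · rw [if_pos hi] at h
      have h' : nNon G H σ ≤ nNon G H (applyMove G σ m) + 1 := by omega
      have := pow_le_pow_of_le_one (by norm_num : (0 : ℝ) ≤ 1 / 2) (by norm_num) h'
      rw [pow_succ] at this
      simp only [hj, hi, not_false_eq_true, if_true]
      linarith

theorem transition_half_pow_nNon_le {n : ℕ} (hn : 2 ≤ n) (H : Subgroup G) :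
    transition (fun σ : Config G n => (1 / 2 : ℝ) ^ nNon G H σ) ≤
      fun σ => (1 / 2 : ℝ) ^ nNon G H σ + 2 * (1 / 2 : ℝ) ^ ((n : ℝ) / 3) := by
  intro σ
  have hM := card_move_pos hn
  have hnn : (0 : ℝ) ≤ (1 / 2 : ℝ) ^ ((n : ℝ) / 3) := by positivity
  have hΦ : (0 : ℝ) ≤ (1 / 2 : ℝ) ^ nNon G H σ := by positivity
  simp only [transition]
  rw [div_le_iff₀ hM]
  by_cases hN : 3 * nNon G H σ ≤ n
  · set e : Fin n → ℝ := fun i => if σ i ∉ H then 1 else 0 with he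
    have hsum : ∑ i, e i = nNon G H σ := by
      simp [he, nNon, Finset.sum_ite]
    have hdiag : 0 ≤ ∑ i, ∑ _b : Bool, e i * (3 * e i - 1) / 2 := by
      refine Finset.sum_nonneg fun i _ => Finset.sum_nonneg fun b _ => ?_
      by_cases h : σ i ∈ H <;> simp [he, h]; norm_num
    have hfull : ∑ i, ∑ j, ∑ _b : Bool, e j * (3 * e i - 1) / 2 =
        (nNon G H σ : ℝ) * (3 * nNon G H σ - n) := by
      have : ∀ i, ∑ j, ∑ _b : Bool, e j * (3 * e i - 1) / 2 =
          (nNon G H σ : ℝ) * (3 * e i - 1) := by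
        intro i
        rw [← hsum, Finset.sum_mul]
        refine Finset.sum_congr rfl fun j _ => ?_
        simp only [Finset.sum_const, Finset.card_univ, Fintype.card_bool, nsmul_eq_mul]
        push_cast
        ring
      rw [Finset.sum_congr rfl fun i _ => this i, ← Finset.mul_sum, Finset.sum_sub_distrib,
        ← Finset.mul_sum, hsum]
      simp
    have hS : ∑ m : Move n, e m.1.1.2 * (3 * e m.1.1.1 - 1) / 2 ≤ 0 := by
      rw [sum_move (fun i j _ => e j * (3 * e i - 1) / 2), hfull]
      have hN' : (3 * nNon G H σ : ℝ) ≤ n := by exact_mod_cast hN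
      have : (0 : ℝ) ≤ nNon G H σ := by positivity
      nlinarith
    calc ∑ m : Move n, (1 / 2 : ℝ) ^ nNon G H (applyMove G σ m)
        ≤ ∑ m : Move n, (1 / 2 : ℝ) ^ nNon G H σ *
            (1 + e m.1.1.2 * (3 * e m.1.1.1 - 1) / 2) :=
          Finset.sum_le_sum fun m _ => half_pow_nNon_applyMove_le H σ m
      _ = (1 / 2 : ℝ) ^ nNon G H σ * (Fintype.card (Move n) +
            ∑ m : Move n, e m.1.1.2 * (3 * e m.1.1.1 - 1) / 2) := by
          rw [← Finset.mul_sum, Finset.sum_add_distrib]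
          simp
      _ ≤ _ := by nlinarith [mul_nonneg hnn hM.le]
  · have hle : (1 / 2 : ℝ) ^ nNon G H σ ≤ (1 / 2 : ℝ) ^ ((n : ℝ) / 3) := by
      rw [← Real.rpow_natCast]
      refine Real.rpow_le_rpow_of_exponent_ge (by norm_num) (by norm_num) ?_
      have : (n : ℝ) < 3 * nNon G H σ := by exact_mod_cast not_le.1 hN
      linarith
    have hb : ∀ m : Move n, (1 / 2 : ℝ) ^ nNon G H (applyMove G σ m) ≤
        2 * (1 / 2 : ℝ) ^ nNon G H σ := by
      intro m
      refine (half_pow_nNon_applyMove_le H σ m).trans ?_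
      rw [mul_comm]
      refine mul_le_mul_of_nonneg_right ?_ hΦ
      split_ifs <;> norm_num
    refine (Finset.sum_le_sum fun m _ => hb m).trans ?_
    rw [Finset.sum_const, Finset.card_univ, nsmul_eq_mul, mul_comm]
    refine mul_le_mul_of_nonneg_right ?_ hM.le
    linarith

theorem iterate_transition_half_pow_nNon_le {n : ℕ} (hn : 2 ≤ n) (H : Subgroup G) (t : ℕ) :
    transition^[t] (fun σ : Config G n => (1 / 2 : ℝ) ^ nNon G H σ) ≤
      fun σ => (1 / 2 : ℝ) ^ nNon G H σ + t * (2 * (1 / 2 : ℝ) ^ ((n : ℝ) / 3)) := by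
  induction t with
  | zero => intro σ; simp
  | succ t ih =>
    intro σ
    rw [Function.iterate_succ, Function.comp_apply]
    have h1 := iterate_transition_mono t (transition_half_pow_nNon_le hn H) σ
    refine h1.trans ?_
    change transition^[t] ((fun σ : Config G n => (1 / 2 : ℝ) ^ nNon G H σ) +
      fun _ => 2 * (1 / 2 : ℝ) ^ ((n : ℝ) / 3)) σ ≤ _
    rw [iterate_transition_add, iterate_transition_const hn]
    have := ih σ
    simp only [Pi.add_apply] at this ⊢
    push_cast
    linarith

/-- Configurations with at least a sixth of the sites outside every proper subgroup. -/
def spread (G : Type) [Group G] (n : ℕ) : Set (Config G n) :=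
  {σ | ∀ H : Subgroup G, H ≠ ⊤ → (n : ℝ) / 6 ≤ nNon G H σ}

variable [Fintype G]

theorem indicator_compl_spread_le {n : ℕ} :
    (spread G n)ᶜ.indicator (1 : Config G n → ℝ) ≤
      ∑ H ∈ Finset.univ.filter (fun H : Subgroup G => H ≠ ⊤),
        ((2 : ℝ) ^ ((n : ℝ) / 6)) • fun σ : Config G n => (1 / 2 : ℝ) ^ nNon G H σ := by
  intro σ
  rw [Finset.sum_apply]
  by_cases hσ : σ ∈ (spread G n)ᶜ
  · rw [Set.indicator_of_mem hσ]
    simp only [spread, Set.mem_compl_iff, Set.mem_ofPred_eq, not_forall, not_le] at hσ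
    obtain ⟨H, hH, hlt⟩ := hσ
    refine le_trans ?_ (Finset.single_le_sum (s := Finset.univ.filter
      (fun H : Subgroup G => H ≠ ⊤)) (f := fun H : Subgroup G =>
      (((2 : ℝ) ^ ((n : ℝ) / 6)) • fun σ : Config G n => (1 / 2 : ℝ) ^ nNon G H σ) σ)
      (fun H _ => by simp only [Pi.smul_apply, smul_eq_mul]; positivity)
      (Finset.mem_filter.2 ⟨Finset.mem_univ H, hH⟩))
    simp only [Pi.smul_apply, smul_eq_mul, Pi.one_apply]
    rw [one_div, inv_pow, ← div_eq_mul_inv, one_le_div (by positivity), ← Real.rpow_natCast]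
    exact Real.rpow_le_rpow_of_exponent_le (by norm_num) hlt.le
  · rw [Set.indicator_of_notMem hσ]
    exact Finset.sum_nonneg fun H _ => by simp only [Pi.smul_apply, smul_eq_mul]; positivity

/-- Started from `SNon G n (1 / 3)`, the chain leaves `spread G n` with exponentially small
probability. -/
theorem iterate_transition_compl_spread_le {n : ℕ} (hn : 2 ≤ n) (σ : Config G n)
    (hσ : σ ∈ SNon G n (1 / 3)) (t : ℕ) :
    transition^[t] ((spread G n)ᶜ.indicator 1) σ ≤
      Fintype.card (Subgroup G) * ((1 + 2 * t) * (1 / 2 : ℝ) ^ ((n : ℝ) / 6)) := by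
  refine (iterate_transition_mono t indicator_compl_spread_le σ).trans ?_
  rw [iterate_transition_sum, Finset.sum_apply]
  have hterm : ∀ H ∈ Finset.univ.filter (fun H : Subgroup G => H ≠ ⊤),
      transition^[t] (((2 : ℝ) ^ ((n : ℝ) / 6)) • fun σ : Config G n =>
        (1 / 2 : ℝ) ^ nNon G H σ) σ ≤ (1 + 2 * t) * (1 / 2 : ℝ) ^ ((n : ℝ) / 6) := by
    intro H hH
    rw [iterate_transition_smul]
    have h1 := iterate_transition_half_pow_nNon_le hn H t σ
    have h2 : (1 / 2 : ℝ) ^ nNon G H σ ≤ (1 / 2 : ℝ) ^ ((n : ℝ) / 3) := by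
      rw [← Real.rpow_natCast]
      refine Real.rpow_le_rpow_of_exponent_ge (by norm_num) (by norm_num) ?_
      have := hσ.2 H (Finset.mem_filter.1 hH).2
      linarith
    have h3 : (2 : ℝ) ^ ((n : ℝ) / 6) * (1 / 2 : ℝ) ^ ((n : ℝ) / 3) =
        (1 / 2 : ℝ) ^ ((n : ℝ) / 6) := by
      rw [show (n : ℝ) / 3 = n / 6 + n / 6 by ring, Real.rpow_add (by norm_num), ← mul_assoc,
        ← Real.mul_rpow (by norm_num) (by norm_num)]
      norm_num
    have h4 : (0 : ℝ) ≤ (2 : ℝ) ^ ((n : ℝ) / 6) := by positivity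
    calc (2 : ℝ) ^ ((n : ℝ) / 6) * transition^[t] (fun σ : Config G n =>
          (1 / 2 : ℝ) ^ nNon G H σ) σ
        ≤ (2 : ℝ) ^ ((n : ℝ) / 6) * ((1 / 2 : ℝ) ^ ((n : ℝ) / 3) +
            t * (2 * (1 / 2 : ℝ) ^ ((n : ℝ) / 3))) := by
          gcongr
          linarith
      _ = (1 + 2 * t) * ((2 : ℝ) ^ ((n : ℝ) / 6) * (1 / 2 : ℝ) ^ ((n : ℝ) / 3)) := by ring
      _ = _ := by rw [h3]
  refine (Finset.sum_le_sum hterm).trans ?_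
  rw [Finset.sum_const, nsmul_eq_mul]
  have : ((Finset.univ.filter (fun H : Subgroup G => H ≠ ⊤)).card : ℝ) ≤
      Fintype.card (Subgroup G) := by exact_mod_cast Finset.card_le_univ _
  gcongr

end PR
open scoped InnerProductSpace

namespace PR

/-- A right action of `G` on a real inner product space by linear isometries, without nonzero
fixed vectors. -/
structure IsometricAction (G V : Type*) [Group G] [Fintype G] [NormedAddCommGroup V]
    [InnerProductSpace ℝ V] where
  /-- The isometry attached to a group element. -/
  act : G → V →ₗᵢ[ℝ] V
  act_one : ∀ x, act 1 x = x
  act_mul : ∀ a b x, act (a * b) x = act b (act a x)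
  sum_act : ∀ x, ∑ a, act a x = 0

/-- The displacement constant of a fixed-vector free isometric action of `G`. -/
def gap (G : Type*) [Fintype G] : ℝ := 1 / 2 ^ (Fintype.card G + 1)

theorem gap_pos {G : Type*} [Fintype G] : 0 < gap G := by
  unfold gap
  positivity

theorem gap_sq_le_one {G : Type*} [Fintype G] : gap G ^ 2 ≤ 1 := by
  refine pow_le_one₀ gap_pos.le ?_
  rw [gap, div_le_one (by positivity)]
  exact one_le_pow₀ (by norm_num)

variable {G : Type} [Group G] [Fintype G] {V : Type*} [NormedAddCommGroup V]
  [InnerProductSpace ℝ V]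

namespace IsometricAction

variable (R : IsometricAction G V)

theorem norm_act_inv_sub (a : G) (x : V) : ‖R.act a⁻¹ x - x‖ = ‖R.act a x - x‖ := by
  rw [← (R.act a).norm_map, map_sub, ← R.act_mul, inv_mul_cancel, R.act_one, norm_sub_rev]

theorem norm_act_mul_sub_le (a b : G) (x : V) :
    ‖R.act (a * b) x - x‖ ≤ ‖R.act a x - x‖ + ‖R.act b x - x‖ := by
  rw [R.act_mul, ← (R.act b).norm_map (R.act a x - x), map_sub]
  exact norm_sub_le_norm_sub_add_norm_sub _ _ _

/-- Every nonzero vector is displaced by a definite proportion by all elements outside some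
proper subgroup. -/
theorem exists_subgroup_gap {x : V} (hx : x ≠ 0) :
    ∃ H : Subgroup G, H ≠ ⊤ ∧ ∀ a ∉ H, gap G * ‖x‖ ≤ ‖R.act a x - x‖ := by
  have hx' : 0 < ‖x‖ := norm_pos_iff.2 hx
  have hg := gap_pos (G := G)
  set B : ℕ → Finset G := fun k =>
    Finset.univ.filter (fun a => ‖R.act a x - x‖ ≤ 2 ^ k * (gap G * ‖x‖)) with hB
  have hmem : ∀ k a, a ∈ B k ↔ ‖R.act a x - x‖ ≤ 2 ^ k * (gap G * ‖x‖) := by simp [hB]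
  have hmono : ∀ k, B k ⊆ B (k + 1) := by
    intro k a ha
    rw [hmem] at ha ⊢
    refine ha.trans ?_
    gcongr
    · norm_num
    · omega
  obtain ⟨k, hk, hkeq⟩ : ∃ k ≤ Fintype.card G, B k = B (k + 1) := by
    by_contra! hne
    have hcard : ∀ k ≤ Fintype.card G + 1, k ≤ (B k).card := by
      intro k
      induction k with
      | zero => simp
      | succ k ih =>
        intro hk
        have h1 := ih (by omega)
        have h2 := Finset.card_lt_card ((hmono k).ssubset_of_ne (hne k (by omega)))
        omega
    have h1 := hcard _ le_rfl
    have h2 := Finset.card_le_univ (B (Fintype.card G + 1))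
    omega
  let H : Subgroup G :=
    { carrier := {a | a ∈ B k}
      mul_mem' := by
        intro a b ha hb
        change a * b ∈ B k
        change a ∈ B k at ha
        change b ∈ B k at hb
        rw [hmem] at ha hb
        rw [hkeq, hmem]
        have := R.norm_act_mul_sub_le a b x
        rw [pow_succ]
        linarith
      one_mem' := by
        change (1 : G) ∈ B k
        rw [hmem, R.act_one, sub_self, norm_zero]
        positivity
      inv_mem' := by
        intro a ha
        change a⁻¹ ∈ B k
        change a ∈ B k at ha
        rw [hmem] at ha ⊢
        rwa [R.norm_act_inv_sub] }
  refine ⟨H, fun htop => ?_, fun a ha => ?_⟩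
  · have hall : ∀ a, ‖R.act a x - x‖ ≤ 2 ^ k * (gap G * ‖x‖) := fun a =>
      (hmem k a).1 (show a ∈ H by rw [htop]; trivial)
    have h1 : ∑ a, (R.act a x - x) = -((Fintype.card G : ℝ) • x) := by
      rw [Finset.sum_sub_distrib, R.sum_act, Finset.sum_const, Finset.card_univ, zero_sub,
        Nat.cast_smul_eq_nsmul]
    have h2 : (Fintype.card G : ℝ) * ‖x‖ ≤ Fintype.card G * (2 ^ k * (gap G * ‖x‖)) := by
      calc (Fintype.card G : ℝ) * ‖x‖ = ‖∑ a, (R.act a x - x)‖ := by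
            rw [h1, norm_neg, norm_smul, Real.norm_natCast]
        _ ≤ ∑ a, ‖R.act a x - x‖ := norm_sum_le _ _
        _ ≤ ∑ _a : G, 2 ^ k * (gap G * ‖x‖) := Finset.sum_le_sum fun a _ => hall a
        _ = _ := by rw [Finset.sum_const, Finset.card_univ, nsmul_eq_mul]
    have hQ : (0 : ℝ) < Fintype.card G := by exact_mod_cast Fintype.card_pos
    have h3 := le_of_mul_le_mul_left h2 hQ
    have h4 : (2 : ℝ) ^ k * gap G ≤ 1 / 2 := by
      have : (2 : ℝ) ^ k ≤ 2 ^ Fintype.card G := pow_le_pow_right₀ (by norm_num) hk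
      rw [gap, mul_one_div, div_le_div_iff₀ (by positivity) (by norm_num), pow_succ]
      linarith
    nlinarith
  · have ha' : a ∉ B k := ha
    rw [hmem, not_le] at ha'
    refine le_trans ?_ ha'.le
    have : (1 : ℝ) ≤ 2 ^ k := one_le_pow₀ (by norm_num)
    exact le_mul_of_one_le_left (by positivity) this

theorem sum_norm_act_sub_sq_ge {n : ℕ} {σ : Config G n} (hσ : σ ∈ spread G n) (x : V) :
    (n : ℝ) / 6 * (gap G ^ 2 * ‖x‖ ^ 2) ≤ ∑ j, ‖R.act (σ j) x - x‖ ^ 2 := by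
  by_cases hx : x = 0
  · simp [hx]
  obtain ⟨H, hH, hgap⟩ := R.exists_subgroup_gap hx
  have hg := gap_pos (G := G)
  calc (n : ℝ) / 6 * (gap G ^ 2 * ‖x‖ ^ 2)
      ≤ nNon G H σ * (gap G ^ 2 * ‖x‖ ^ 2) := by
        gcongr
        exact hσ H hH
    _ = ∑ j ∈ Finset.univ.filter (fun j => σ j ∉ H), (gap G * ‖x‖) ^ 2 := by
        rw [Finset.sum_const, nsmul_eq_mul, mul_pow]
        rfl
    _ ≤ ∑ j ∈ Finset.univ.filter (fun j => σ j ∉ H), ‖R.act (σ j) x - x‖ ^ 2 := by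
        refine Finset.sum_le_sum fun j hj => ?_
        gcongr
        exact hgap _ (Finset.mem_filter.1 hj).2
    _ ≤ _ := Finset.sum_le_sum_of_subset_of_nonneg (Finset.filter_subset _ _)
        fun _ _ _ => by positivity

theorem inner_act_sub (a : G) (x : V) : ⟪x, R.act a x - x⟫_ℝ = -‖R.act a x - x‖ ^ 2 / 2 := by
  have h := norm_add_sq_real x (R.act a x - x)
  rw [add_sub_cancel, (R.act a).norm_map] at h
  linarith

/-- The empirical average of the orbit of `u` along a configuration. -/
def mean (u : V) {n : ℕ} (σ : Config G n) : V := (n : ℝ)⁻¹ • ∑ i, R.act (σ i) u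

theorem norm_mean_le (u : V) {n : ℕ} (σ : Config G n) : ‖R.mean u σ‖ ≤ ‖u‖ := by
  rw [mean, norm_smul, Real.norm_of_nonneg (by positivity)]
  rcases Nat.eq_zero_or_pos n with rfl | hn
  · simp
  · have hn' : (0 : ℝ) < n := by exact_mod_cast hn
    rw [inv_mul_le_iff₀ hn']
    refine (norm_sum_le _ _).trans ?_
    simp

theorem mean_applyMove (u : V) {n : ℕ} (σ : Config G n) (m : Move n) :
    R.mean u (applyMove G σ m) = R.mean u σ + (n : ℝ)⁻¹ •
      (R.act (if m.2 then σ m.1.1.2 else (σ m.1.1.2)⁻¹) (R.act (σ m.1.1.1) u) -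
        R.act (σ m.1.1.1) u) := by
  have h := sum_comp_update (fun a => R.act a u) σ m.1.1.1
    (σ m.1.1.1 * (if m.2 then σ m.1.1.2 else (σ m.1.1.2)⁻¹))
  rw [R.act_mul, ← eq_sub_iff_add_eq, add_sub_assoc] at h
  rw [mean, mean, ← smul_add, ← h]
  rfl

theorem norm_act_sub_le (a : G) (x : V) : ‖R.act a x - x‖ ≤ 2 * ‖x‖ := by
  refine (norm_sub_le _ _).trans ?_
  rw [(R.act a).norm_map]
  linarith

/-- The mean displacement over all moves points towards the origin. -/
theorem sum_inner_displacement_le (u : V) {n : ℕ} (hn : 2 ≤ n) {σ : Config G n}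
    (hσ : σ ∈ spread G n) :
    ∑ m : Move n, ⟪R.mean u σ,
      R.act (if m.2 then σ m.1.1.2 else (σ m.1.1.2)⁻¹) (R.act (σ m.1.1.1) u) -
        R.act (σ m.1.1.1) u⟫_ℝ ≤
      -((n : ℝ) * (n / 6 * (gap G ^ 2 * ‖R.mean u σ‖ ^ 2))) + n * (4 * ‖u‖ ^ 2) := by
  have hn' : (n : ℝ) ≠ 0 := by positivity
  set x := R.mean u σ with hx
  have hxs : ∑ i, R.act (σ i) u = (n : ℝ) • x := by
    rw [hx, mean, smul_inv_smul₀ hn']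
  rw [sum_move (fun i j b => ⟪x, R.act (if b then σ j else (σ j)⁻¹) (R.act (σ i) u) -
        R.act (σ i) u⟫_ℝ)]
  have hfull : ∑ i, ∑ j, ∑ b : Bool, ⟪x, R.act (if b then σ j else (σ j)⁻¹) (R.act (σ i) u) -
        R.act (σ i) u⟫_ℝ = -((n : ℝ) * ∑ j, ‖R.act (σ j) x - x‖ ^ 2) := by
    rw [Finset.sum_comm, Finset.mul_sum, ← Finset.sum_neg_distrib]
    refine Finset.sum_congr rfl fun j _ => ?_
    rw [Finset.sum_comm]
    have : ∀ v : G, ∑ i, ⟪x, R.act v (R.act (σ i) u) - R.act (σ i) u⟫_ℝ =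
        n * (-‖R.act v x - x‖ ^ 2 / 2) := by
      intro v
      rw [← inner_sum, Finset.sum_sub_distrib, ← map_sum, hxs, map_smul, ← smul_sub,
        inner_smul_right, R.inner_act_sub]
    simp only [this, Fintype.sum_bool, if_true, Bool.false_eq_true, if_false,
      R.norm_act_inv_sub]
    ring
  have hdiag : -((n : ℝ) * (4 * ‖u‖ ^ 2)) ≤
      ∑ i, ∑ b : Bool, ⟪x, R.act (if b then σ i else (σ i)⁻¹) (R.act (σ i) u) -
        R.act (σ i) u⟫_ℝ := by
    have hb : ∀ i, ∀ b : Bool, -(2 * ‖u‖ ^ 2) ≤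
        ⟪x, R.act (if b then σ i else (σ i)⁻¹) (R.act (σ i) u) - R.act (σ i) u⟫_ℝ := by
      intro i b
      refine (neg_le_neg ?_).trans (neg_abs_le _)
      refine (abs_real_inner_le_norm _ _).trans ?_
      have h1 := R.norm_act_sub_le (if b then σ i else (σ i)⁻¹) (R.act (σ i) u)
      rw [(R.act (σ i)).norm_map] at h1
      have h2 := R.norm_mean_le u σ
      rw [sq, ← mul_assoc, mul_comm 2 ‖u‖, mul_assoc]
      gcongr
    have := Finset.sum_le_sum fun i (_ : i ∈ (Finset.univ : Finset (Fin n))) =>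
      Finset.sum_le_sum fun b (_ : b ∈ (Finset.univ : Finset Bool)) => hb i b
    refine le_trans (le_of_eq ?_) this
    simp only [Finset.sum_const, Finset.card_univ, Fintype.card_bool, Fintype.card_fin,
      nsmul_eq_mul]
    push_cast
    ring
  rw [hfull]
  have := R.sum_norm_act_sub_sq_ge hσ x
  have h3 : (n : ℝ) * (n / 6 * (gap G ^ 2 * ‖x‖ ^ 2)) ≤
      n * ∑ j, ‖R.act (σ j) x - x‖ ^ 2 := by gcongr
  linarith

/-- One-step contraction of exponential moments of the squared norm of the mean. -/
theorem transition_exp_le (u : V) {q : ℝ} (hq : 1 ≤ q) (hu : ‖u‖ ^ 2 ≤ q) {n : ℕ} (hn : 2 ≤ n)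
    (hnq : 16 * q ^ 2 ≤ n) {l : ℝ} (hl : 0 ≤ l) (hln : l ^ 2 ≤ n) {σ : Config G n}
    (hσ : σ ∈ spread G n) :
    transition (fun τ : Config G n => Real.exp (l * ‖R.mean u τ‖ ^ 2)) σ ≤
      Real.exp (l * (1 - gap G ^ 2 / (6 * n)) * ‖R.mean u σ‖ ^ 2 +
        16 * q ^ 2 * (l + l ^ 2) / n ^ 2) := by
  have hnR : (2 : ℝ) ≤ n := by exact_mod_cast hn
  have hn0 : (0 : ℝ) < n := by linarith
  have hM := card_move_pos hn
  have hMe := card_move n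
  have hdrift := R.sum_inner_displacement_le u hn hσ
  set x := R.mean u σ with hx
  set y : Move n → V := fun m =>
    R.act (if m.2 then σ m.1.1.2 else (σ m.1.1.2)⁻¹) (R.act (σ m.1.1.1) u) -
        R.act (σ m.1.1.1) u with hy
  set M : ℝ := (Fintype.card (Move n) : ℝ)
  set w : Move n → ℝ := fun m => l * (2 * ((n : ℝ)⁻¹ * ⟪x, y m⟫_ℝ)) with hw
  have hxu : ‖x‖ ≤ ‖u‖ := R.norm_mean_le u σ
  have hyu : ∀ m, ‖y m‖ ≤ 2 * ‖u‖ := fun m => by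
    have h1 := R.norm_act_sub_le (if m.2 then σ m.1.1.2 else (σ m.1.1.2)⁻¹)
      (R.act (σ m.1.1.1) u)
    rwa [(R.act (σ m.1.1.1)).norm_map] at h1
  have hin : ∀ m, |⟪x, y m⟫_ℝ| ≤ 2 * q := fun m => by
    refine (abs_real_inner_le_norm _ _).trans ?_
    have := mul_le_mul hxu (hyu m) (norm_nonneg _) (norm_nonneg _)
    nlinarith
  have hwabs : ∀ m, |w m| ≤ 4 * q * l / n := fun m => by
    rw [hw]
    simp only [abs_mul, abs_of_nonneg hl, abs_two, abs_of_pos (inv_pos.2 hn0)]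
    rw [div_eq_mul_inv]
    have := mul_le_mul_of_nonneg_left (hin m) (by positivity : 0 ≤ l * 2 * (n : ℝ)⁻¹)
    linarith
  have hsmall : 4 * q * l / n ≤ 1 := by
    rw [div_le_one hn0]
    refine abs_le_of_sq_le_sq' ?_ hn0.le |>.2
    nlinarith [sq_nonneg l, sq_nonneg q]
  have hexpw : ∀ m, Real.exp (w m) ≤ 1 + w m + 16 * q ^ 2 * l ^ 2 / n ^ 2 := fun m => by
    have h1 := Real.abs_exp_sub_one_sub_id_le ((hwabs m).trans hsmall)
    have h2 := (abs_le.1 h1).2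
    have h3 : w m ^ 2 ≤ (4 * q * l / n) ^ 2 := sq_le_sq' (by linarith [(abs_le.1 (hwabs m)).1])
      (abs_le.1 (hwabs m)).2
    have h4 : (4 * q * l / n) ^ 2 = 16 * q ^ 2 * l ^ 2 / n ^ 2 := by ring
    linarith
  have hpoint : ∀ m, Real.exp (l * ‖R.mean u (applyMove G σ m)‖ ^ 2) ≤
      Real.exp (l * ‖x‖ ^ 2 + 4 * q * l / n ^ 2) *
        (1 + w m + 16 * q ^ 2 * l ^ 2 / n ^ 2) := fun m => by
    refine le_trans ?_ (mul_le_mul_of_nonneg_left (hexpw m) (Real.exp_pos _).le)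
    rw [← Real.exp_add, Real.exp_le_exp, R.mean_applyMove, norm_add_sq_real, inner_smul_right,
      norm_smul, Real.norm_of_nonneg (by positivity : (0 : ℝ) ≤ (n : ℝ)⁻¹)]
    have h1 : ((n : ℝ)⁻¹ * ‖y m‖) ^ 2 ≤ 4 * q / n ^ 2 := by
      have h2 : ‖y m‖ ^ 2 ≤ 4 * q := by nlinarith [hyu m, norm_nonneg (y m)]
      rw [mul_pow, inv_pow, inv_mul_eq_div]
      gcongr
    have h2 := mul_le_mul_of_nonneg_left h1 hl
    have h3 : l * (4 * q / n ^ 2) = 4 * q * l / (n : ℝ) ^ 2 := by ring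
    rw [h3] at h2
    simp only [hw]
    linarith
  have hsumw : (∑ m, w m) / M ≤ -(l * (gap G ^ 2 / (6 * n)) * ‖x‖ ^ 2) + 8 * q * l / n ^ 2 := by
    rw [div_le_iff₀ hM]
    have h1 : ∑ m, w m = 2 * l / n * ∑ m, ⟪x, y m⟫_ℝ := by
      rw [Finset.mul_sum]
      refine Finset.sum_congr rfl fun m _ => ?_
      simp only [hw]
      ring
    rw [h1, hMe]
    refine (mul_le_mul_of_nonneg_left hdrift (by positivity)).trans ?_
    have e1 : 2 * l / n * (-((n : ℝ) * (n / 6 * (gap G ^ 2 * ‖x‖ ^ 2))) + n * (4 * ‖u‖ ^ 2)) =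
        -(l * (gap G ^ 2 / 3) * ‖x‖ ^ 2 * n) + 8 * l * ‖u‖ ^ 2 := by
      field_simp
      ring
    have e2 : (-(l * (gap G ^ 2 / (6 * n)) * ‖x‖ ^ 2) + 8 * q * l / n ^ 2) *
        (2 * (n * (n - 1))) =
        -(l * (gap G ^ 2 / 3) * ‖x‖ ^ 2 * (n - 1)) + 8 * l * q * (2 * (n - 1) / n) := by
      field_simp
      ring
    rw [e1, e2]
    have e3 : 1 ≤ 2 * ((n : ℝ) - 1) / n := by
      rw [le_div_iff₀ hn0]
      linarith
    have e4 : 8 * l * ‖u‖ ^ 2 ≤ 8 * l * q * (2 * (n - 1) / n) := by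
      calc 8 * l * ‖u‖ ^ 2 ≤ 8 * l * q := by gcongr
        _ ≤ _ := le_mul_of_one_le_right (by positivity) e3
    have e5 : 0 ≤ l * (gap G ^ 2 / 3) * ‖x‖ ^ 2 := by positivity
    linarith
  calc transition (fun τ : Config G n => Real.exp (l * ‖R.mean u τ‖ ^ 2)) σ
      ≤ (∑ m : Move n, Real.exp (l * ‖x‖ ^ 2 + 4 * q * l / n ^ 2) *
        (1 + w m + 16 * q ^ 2 * l ^ 2 / n ^ 2)) / M := by
        unfold transition
        gcongr with m
        exact hpoint m
    _ = Real.exp (l * ‖x‖ ^ 2 + 4 * q * l / n ^ 2) *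
        ((∑ m, w m) / M + 16 * q ^ 2 * l ^ 2 / n ^ 2 + 1) := by
        rw [← Finset.mul_sum, Finset.sum_add_distrib, Finset.sum_add_distrib,
          Finset.sum_const, Finset.sum_const, Finset.card_univ, nsmul_eq_mul, nsmul_eq_mul]
        change _ * (M * 1 + _ + M * _) / M = _
        field_simp
        ring
    _ ≤ Real.exp (l * ‖x‖ ^ 2 + 4 * q * l / n ^ 2) *
        Real.exp ((∑ m, w m) / M + 16 * q ^ 2 * l ^ 2 / n ^ 2) := by
        gcongr
        exact Real.add_one_le_exp _
    _ ≤ _ := by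
        rw [← Real.exp_add, Real.exp_le_exp]
        have e1 : 16 * q ^ 2 * (l + l ^ 2) / (n : ℝ) ^ 2 =
            16 * q ^ 2 * l / n ^ 2 + 16 * q ^ 2 * l ^ 2 / n ^ 2 := by ring
        have e2 : 4 * q * l / (n : ℝ) ^ 2 + 8 * q * l / n ^ 2 ≤ 16 * q ^ 2 * l / n ^ 2 := by
          rw [← add_div]
          gcongr
          nlinarith [mul_le_mul_of_nonneg_left hq (by positivity : 0 ≤ q * l)]
        have e3 : l * (1 - gap G ^ 2 / (6 * n)) * ‖x‖ ^ 2 =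
          l * ‖x‖ ^ 2 - l * (gap G ^ 2 / (6 * n)) * ‖x‖ ^ 2 := by ring
        rw [e1, e3]
        linarith

end IsometricAction

end PR
namespace PR

variable {G : Type} [Group G] [Fintype G] {V : Type*} [NormedAddCommGroup V]
  [InnerProductSpace ℝ V]

namespace IsometricAction

variable (R : IsometricAction G V)

theorem transition_exp_le_add (u : V) {q : ℝ} (hq : 1 ≤ q) (hu : ‖u‖ ^ 2 ≤ q) {n : ℕ}
    (hn : 2 ≤ n) (hnq : 16 * q ^ 2 ≤ n) {l : ℝ} (hl : 0 ≤ l) (hln : l ^ 2 ≤ n) :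
    transition (fun τ : Config G n => Real.exp (l * ‖R.mean u τ‖ ^ 2)) ≤
      Real.exp (16 * q ^ 2 * (l + l ^ 2) / n ^ 2) • (fun τ : Config G n =>
        Real.exp (l * (1 - gap G ^ 2 / (6 * n)) * ‖R.mean u τ‖ ^ 2)) +
      Real.exp (l * q) • (spread G n)ᶜ.indicator 1 := by
  intro σ
  simp only [Pi.add_apply, Pi.smul_apply, smul_eq_mul]
  by_cases hσ : σ ∈ spread G n
  · have := R.transition_exp_le u hq hu hn hnq hl hln hσ
    rw [Set.indicator_of_notMem (Set.notMem_compl_iff.2 hσ), mul_zero, add_zero, ← Real.exp_add,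
      add_comm]
    exact this
  · rw [Set.indicator_of_mem (Set.mem_compl hσ), Pi.one_apply, mul_one]
    have h1 : (fun τ : Config G n => Real.exp (l * ‖R.mean u τ‖ ^ 2)) ≤
        fun _ => Real.exp (l * q) := fun τ => by
      refine Real.exp_le_exp.2 (mul_le_mul_of_nonneg_left ?_ hl)
      exact (pow_le_pow_left₀ (norm_nonneg _) (R.norm_mean_le u τ) 2).trans hu
    have h2 := transition_mono h1 σ
    rw [transition_const hn] at h2
    have h3 : 0 ≤ Real.exp (16 * q ^ 2 * (l + l ^ 2) / n ^ 2) *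
        Real.exp (l * (1 - gap G ^ 2 / (6 * n)) * ‖R.mean u σ‖ ^ 2) := by positivity
    linarith

/-- Exponential moments of the squared norm of the mean at time `t`. -/
theorem iterate_transition_exp_le (u : V) {q : ℝ} (hq : 1 ≤ q) (hu : ‖u‖ ^ 2 ≤ q) {n : ℕ}
    (hn : 2 ≤ n) (hnq : 16 * q ^ 2 ≤ n) (σ : Config G n) {T : ℕ} {b : ℝ} (hb : 0 ≤ b)
    (hbad : ∀ t ≤ T, transition^[t] ((spread G n)ᶜ.indicator 1) σ ≤ b) (t : ℕ) (ht : t ≤ T)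
    {l : ℝ} (hl : 0 ≤ l) (hln : l ^ 2 ≤ n) :
    transition^[t] (fun τ : Config G n => Real.exp (l * ‖R.mean u τ‖ ^ 2)) σ ≤
      Real.exp (96 * q ^ 2 / gap G ^ 2 * (l + l ^ 2) / n) *
        (Real.exp (l * (1 - gap G ^ 2 / (6 * n)) ^ t * ‖R.mean u σ‖ ^ 2) +
          t * b * Real.exp (l * q)) := by
  have hnR : (2 : ℝ) ≤ n := by exact_mod_cast hn
  have hn0 : (0 : ℝ) < n := by linarith
  have hg : 0 < gap G ^ 2 := pow_pos gap_pos 2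
  set β : ℝ := 1 - gap G ^ 2 / (6 * n) with hβ
  have hβ1 : β ≤ 1 := by
    have : 0 ≤ gap G ^ 2 / (6 * n) := by positivity
    linarith
  have hβ0 : 0 ≤ β := by
    rw [hβ, sub_nonneg, div_le_one (by positivity)]
    linarith [gap_sq_le_one (G := G)]
  set D : ℝ := 96 * q ^ 2 / gap G ^ 2 with hD
  have hD0 : 0 ≤ D := by positivity
  induction t generalizing l with
  | zero =>
    simp only [Function.iterate_zero, id_eq, pow_zero, mul_one, Nat.cast_zero, zero_mul, add_zero]
    refine le_mul_of_one_le_left (Real.exp_pos _).le (Real.one_le_exp (by positivity))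
  | succ t ih =>
    have hlβ : l * β ≤ l := mul_le_of_le_one_right hl hβ1
    have hlβ0 : 0 ≤ l * β := mul_nonneg hl hβ0
    have h1 := iterate_transition_mono t (R.transition_exp_le_add u hq hu hn hnq hl hln) σ
    rw [iterate_transition_add, iterate_transition_smul, iterate_transition_smul] at h1
    simp only [Pi.add_apply, Pi.smul_apply, smul_eq_mul] at h1
    rw [Function.iterate_succ, Function.comp_apply]
    refine h1.trans ?_
    have h2 := ih (by omega) hlβ0 ((pow_le_pow_left₀ hlβ0 hlβ 2).trans hln)
    have h3 := hbad t (by omega)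
    have hexp : 16 * q ^ 2 * (l + l ^ 2) / n ^ 2 + D * (l * β + (l * β) ^ 2) / n ≤
        D * (l + l ^ 2) / n := by
      have e1 : 16 * q ^ 2 * (l + l ^ 2) / (n : ℝ) ^ 2 = D * (l + l ^ 2) * (1 - β) / n := by
        have hgne : gap G ≠ 0 := gap_pos.ne'
        rw [hD, hβ]
        field_simp
        ring
      rw [e1, ← add_div]
      gcongr
      have : (l * β) ^ 2 ≤ l ^ 2 * β := by
        rw [mul_pow]
        gcongr
        nlinarith
      nlinarith
    have hmul : l * β * β ^ t = l * β ^ (t + 1) := by ring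
    rw [hmul] at h2
    have h4 : 1 ≤ Real.exp (D * (l + l ^ 2) / n) := Real.one_le_exp (by positivity)
    have h5 : Real.exp (l * β * q) ≤ Real.exp (l * q) := by
      gcongr
    calc _ ≤ Real.exp (16 * q ^ 2 * (l + l ^ 2) / n ^ 2) *
            (Real.exp (D * (l * β + (l * β) ^ 2) / n) *
              (Real.exp (l * β ^ (t + 1) * ‖R.mean u σ‖ ^ 2) +
                t * b * Real.exp (l * β * q))) + Real.exp (l * q) * b := by
          gcongr
      _ ≤ Real.exp (D * (l + l ^ 2) / n) *
              (Real.exp (l * β ^ (t + 1) * ‖R.mean u σ‖ ^ 2) + t * b * Real.exp (l * q)) +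
            Real.exp (D * (l + l ^ 2) / n) * (Real.exp (l * q) * b) := by
          rw [← mul_assoc, ← Real.exp_add]
          refine add_le_add ?_ (le_mul_of_one_le_left (by positivity) h4)
          gcongr
      _ = _ := by
          push_cast
          ring

theorem iterate_transition_indicator_le (u : V) {q : ℝ} (hq : 1 ≤ q) (hu : ‖u‖ ^ 2 ≤ q) {n : ℕ}
    (hn : 2 ≤ n) (hnq : 16 * q ^ 2 ≤ n) (σ : Config G n) {T : ℕ} {b : ℝ} (hb : 0 ≤ b)
    (hbad : ∀ t ≤ T, transition^[t] ((spread G n)ᶜ.indicator 1) σ ≤ b) (t : ℕ) (ht : t ≤ T) :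
    transition^[t] ({τ | (n : ℝ) ^ (-(1 / 8 : ℝ)) +
        Real.exp (-(gap G ^ 2 / 12 * t) / n) * ‖R.mean u σ‖ ≤ ‖R.mean u τ‖}.indicator 1) σ ≤
      Real.exp (2 * (96 * q ^ 2 / gap G ^ 2)) * (Real.exp (-(n : ℝ) ^ (1 / 4 : ℝ)) +
          T * b * Real.exp (√n * q)) := by
  have hnR : (2 : ℝ) ≤ n := by exact_mod_cast hn
  have hn0 : (0 : ℝ) < n := by linarith
  have hg : 0 < gap G ^ 2 := pow_pos gap_pos 2
  have hs0 := Real.sqrt_nonneg (n : ℝ)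
  have hs2 : √(n : ℝ) ^ 2 = n := Real.sq_sqrt hn0.le
  have hmain := R.iterate_transition_exp_le u hq hu hn hnq σ hb hbad t ht hs0 hs2.le
  set β : ℝ := 1 - gap G ^ 2 / (6 * n) with hβ
  have hβ0 : 0 ≤ β := by
    rw [hβ, sub_nonneg, div_le_one (by positivity)]
    linarith [gap_sq_le_one (G := G)]
  set Z := ‖R.mean u σ‖ with hZ
  have hZ0 : 0 ≤ Z := norm_nonneg _
  set D : ℝ := 96 * q ^ 2 / gap G ^ 2 with hD
  have hD0 : 0 ≤ D := by positivity
  have hβt : β ^ t ≤ Real.exp (-(gap G ^ 2 / 12 * t) / n) ^ 2 := by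
    have h1 : β ≤ Real.exp (-(gap G ^ 2 / (6 * n))) := by
      have := Real.add_one_le_exp (-(gap G ^ 2 / (6 * n)))
      linarith
    refine (pow_le_pow_left₀ hβ0 h1 t).trans (le_of_eq ?_)
    rw [← Real.exp_nat_mul, ← Real.exp_nat_mul]
    congr 1
    push_cast
    ring
  have hpow : ((n : ℝ) ^ (-(1 / 8 : ℝ))) ^ 2 * √n = (n : ℝ) ^ (1 / 4 : ℝ) := by
    rw [Real.sqrt_eq_rpow, ← Real.rpow_natCast, ← Real.rpow_mul hn0.le, ← Real.rpow_add hn0]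
    norm_num
  have hind : {τ : Config G n | (n : ℝ) ^ (-(1 / 8 : ℝ)) +
        Real.exp (-(gap G ^ 2 / 12 * t) / n) * Z ≤ ‖R.mean u τ‖}.indicator 1 ≤
      Real.exp (-((n : ℝ) ^ (1 / 4 : ℝ) + √n * β ^ t * Z ^ 2)) •
        fun τ : Config G n => Real.exp (√n * ‖R.mean u τ‖ ^ 2) := by
    intro τ
    simp only [Pi.smul_apply, smul_eq_mul]
    by_cases hτ : τ ∈ {τ : Config G n | (n : ℝ) ^ (-(1 / 8 : ℝ)) +
        Real.exp (-(gap G ^ 2 / 12 * t) / n) * Z ≤ ‖R.mean u τ‖}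
    · rw [Set.indicator_of_mem hτ, ← Real.exp_add]
      refine Real.one_le_exp ?_
      rw [Set.mem_ofPred_eq] at hτ
      set E := Real.exp (-(gap G ^ 2 / 12 * t) / n)
      have hE : 0 < E := Real.exp_pos _
      have hr : 0 ≤ (n : ℝ) ^ (-(1 / 8 : ℝ)) := by positivity
      have h1 : ((n : ℝ) ^ (-(1 / 8 : ℝ))) ^ 2 + β ^ t * Z ^ 2 ≤ ‖R.mean u τ‖ ^ 2 := by
        have h2 := pow_le_pow_left₀ (by positivity) hτ 2
        have h3 : β ^ t * Z ^ 2 ≤ E ^ 2 * Z ^ 2 := by gcongr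
        nlinarith [mul_nonneg hr (mul_nonneg hE.le hZ0)]
      have h4 := mul_le_mul_of_nonneg_left h1 hs0
      rw [← hpow]
      linarith
    · rw [Set.indicator_of_notMem hτ]
      positivity
  refine (iterate_transition_mono t hind σ).trans ?_
  rw [iterate_transition_smul, Pi.smul_apply, smul_eq_mul]
  have hDl : D * (√n + √(n : ℝ) ^ 2) / n ≤ 2 * D := by
    rw [div_le_iff₀ hn0, hs2]
    have : √(n : ℝ) ≤ n := by nlinarith
    nlinarith
  have hexpn : Real.exp (-((n : ℝ) ^ (1 / 4 : ℝ) + √n * β ^ t * Z ^ 2)) ≤ 1 := by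
    rw [Real.exp_le_one_iff, neg_nonpos]
    positivity
  have htT : (t : ℝ) ≤ T := by exact_mod_cast ht
  calc _ ≤ Real.exp (-((n : ℝ) ^ (1 / 4 : ℝ) + √n * β ^ t * Z ^ 2)) *
        (Real.exp (2 * D) * (Real.exp (√n * β ^ t * Z ^ 2) + T * b * Real.exp (√n * q))) := by
        refine mul_le_mul_of_nonneg_left (hmain.trans ?_) (Real.exp_pos _).le
        gcongr
    _ = Real.exp (2 * D) * (Real.exp (-(n : ℝ) ^ (1 / 4 : ℝ)) +
          Real.exp (-((n : ℝ) ^ (1 / 4 : ℝ) + √n * β ^ t * Z ^ 2)) *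
            (T * b * Real.exp (√n * q))) := by
        rw [mul_left_comm, mul_add, ← Real.exp_add]
        congr 4
        ring
    _ ≤ _ := by
        refine mul_le_mul_of_nonneg_left (add_le_add le_rfl ?_) (Real.exp_pos _).le
        exact mul_le_of_le_one_left (by positivity) hexpn

end IsometricAction

theorem eventually_tail_bound (D K q : ℝ) (hK : 0 ≤ K) (hq : 0 ≤ q) :
    ∀ᶠ y : ℝ in atTop, y ^ 8 * (Real.exp (2 * D) * (Real.exp (-y) +
      y ^ 8 * (K * ((1 + 2 * y ^ 8) * (1 / 2 : ℝ) ^ (y ^ 4 / 6))) * Real.exp (y ^ 2 * q))) ≤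
        1 / y ^ 12 := by
  have hlim := (Real.tendsto_pow_mul_exp_neg_atTop_nhds_zero 36).const_mul
    (Real.exp (2 * D) * (1 + 3 * K))
  rw [mul_zero] at hlim
  filter_upwards [hlim.eventually_le_const zero_lt_one, eventually_ge_atTop 1,
    eventually_ge_atTop (12 * (q + 1))] with y h1 hy1 hyq
  have hy0 : 0 < y := by linarith
  have hexp : (1 / 2 : ℝ) ^ (y ^ 4 / 6) * Real.exp (y ^ 2 * q) ≤ Real.exp (-y) := by
    rw [Real.rpow_def_of_pos (by norm_num), ← Real.exp_add, Real.exp_le_exp]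
    have hlog : Real.log (1 / 2) ≤ -(1 / 2) := by
      rw [one_div, Real.log_inv]
      linarith [Real.log_two_gt_d9]
    have e1 : Real.log (1 / 2) * (y ^ 4 / 6) ≤ -(1 / 2) * (y ^ 4 / 6) := by gcongr
    have e2 : 12 * (q + 1) * y ^ 2 ≤ y ^ 4 := by
      have : y * y ^ 2 ≤ y ^ 4 := by
        rw [← pow_succ']
        exact pow_le_pow_right₀ hy1 (by norm_num)
      have : 12 * (q + 1) * y ^ 2 ≤ y * y ^ 2 := by gcongr
      linarith
    nlinarith
  rw [le_div_iff₀ (by positivity)]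
  calc _ = y ^ 20 * (Real.exp (2 * D) * (Real.exp (-y) + K * (y ^ 8 + 2 * y ^ 16) *
          ((1 / 2 : ℝ) ^ (y ^ 4 / 6) * Real.exp (y ^ 2 * q)))) := by ring
    _ ≤ y ^ 20 * (Real.exp (2 * D) * (y ^ 16 * Real.exp (-y) + K * (y ^ 16 + 2 * y ^ 16) *
          Real.exp (-y))) := by
        gcongr
        · exact le_mul_of_one_le_left (Real.exp_pos _).le (one_le_pow₀ hy1)
        · norm_num
    _ = Real.exp (2 * D) * (1 + 3 * K) * (y ^ 36 * Real.exp (-y)) := by ring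
    _ ≤ 1 := h1

theorem IsometricAction.eventually_sum_iterate_transition_le (G : Type) [Group G] [Fintype G] :
    ∀ᶠ n : ℕ in atTop, 2 ≤ n ∧ ∀ (V : Type) [NormedAddCommGroup V] [InnerProductSpace ℝ V]
      (R : IsometricAction G V) (u : V), ‖u‖ ^ 2 ≤ Fintype.card G → ∀ σ ∈ SNon G n (1 / 3),
      ∑ t ∈ Finset.Icc 1 (n ^ 2), transition^[t] ({τ | (n : ℝ) ^ (-(1 / 8 : ℝ)) +
        Real.exp (-(gap G ^ 2 / 12 * t) / n) * ‖R.mean u σ‖ ≤ ‖R.mean u τ‖}.indicator 1) σ ≤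
      1 / (n : ℝ) ^ 3 := by
  have hq : (1 : ℝ) ≤ Fintype.card G := by exact_mod_cast Fintype.card_pos
  set q : ℝ := ((Fintype.card G : ℕ) : ℝ) with hqdef
  set K : ℝ := ((Fintype.card (Subgroup G) : ℕ) : ℝ) with hK
  have hy : Tendsto (fun n : ℕ => (n : ℝ) ^ (1 / 4 : ℝ)) atTop atTop :=
    (tendsto_rpow_atTop (by norm_num)).comp tendsto_natCast_atTop_atTop
  filter_upwards [hy.eventually (eventually_tail_bound (96 * q ^ 2 / gap G ^ 2) K q
    (by positivity) (by positivity)), eventually_ge_atTop 2,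
    tendsto_natCast_atTop_atTop.eventually_ge_atTop (16 * q ^ 2)] with n hbound hn hnq
  refine ⟨hn, fun V _ _ R u hu σ hσ => ?_⟩
  set y : ℝ := (n : ℝ) ^ (1 / 4 : ℝ) with hydef
  have hy4 : y ^ 4 = n := by
    rw [hydef, ← Real.rpow_natCast, ← Real.rpow_mul (by positivity)]
    norm_num
  have hy2 : √(n : ℝ) = y ^ 2 := by
    rw [← hy4, show y ^ 4 = (y ^ 2) ^ 2 by ring, Real.sqrt_sq (by positivity)]
  set b : ℝ := K * ((1 + 2 * (n ^ 2 : ℕ)) * (1 / 2 : ℝ) ^ ((n : ℝ) / 6)) with hb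
  have hbad : ∀ t ≤ n ^ 2, transition^[t] ((spread G n)ᶜ.indicator 1) σ ≤ b := fun t ht => by
    refine (iterate_transition_compl_spread_le hn σ hσ t).trans ?_
    have : (t : ℝ) ≤ (n ^ 2 : ℕ) := by exact_mod_cast ht
    rw [hb]
    gcongr
  refine (Finset.sum_le_sum fun t ht => R.iterate_transition_indicator_le u hq hu hn hnq σ
    (by positivity : 0 ≤ b) hbad t (Finset.mem_Icc.1 ht).2).trans ?_
  rw [Finset.sum_const, Nat.card_Icc, nsmul_eq_mul, hy2, Nat.add_sub_cancel, hb, ← hydef]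
  push_cast
  rw [← hy4]
  refine le_trans (le_of_eq ?_) (hbound.trans (le_of_eq ?_))
  · ring
  · ring

end PR
namespace PR

section HilbertSchmidt

variable {d : ℕ}

/-- Matrices as vectors of a Euclidean space. -/
def vecEquiv (d : ℕ) :
    Matrix (Fin d) (Fin d) ℂ ≃ₗ[ℝ] PiLp 2 (fun _ : Fin d × Fin d => ℂ) :=
  (Matrix.ofLinearEquiv ℝ).symm ≪≫ₗ (LinearEquiv.curry ℝ ℂ (Fin d) (Fin d)).symm ≪≫ₗ
    (WithLp.linearEquiv 2 ℝ (Fin d × Fin d → ℂ)).symm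

theorem norm_vecEquiv (A : Matrix (Fin d) (Fin d) ℂ) : ‖vecEquiv d A‖ = hsNorm A := by
  rw [PiLp.norm_eq_of_L2, Fintype.sum_prod_type]
  rfl

theorem sum_norm_sq_eq_trace (A : Matrix (Fin d) (Fin d) ℂ) :
    ((∑ i, ∑ j, ‖A i j‖ ^ 2 : ℝ) : ℂ) = (A * star A).trace := by
  simp only [Matrix.trace, Matrix.diag_apply, Matrix.mul_apply, Matrix.star_apply]
  push_cast
  refine Finset.sum_congr rfl fun i _ => Finset.sum_congr rfl fun j _ => ?_
  exact (RCLike.mul_conj (A i j)).symm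

theorem hsNorm_mul_unitary (A : Matrix (Fin d) (Fin d) ℂ) (U : Matrix.unitaryGroup (Fin d) ℂ) :
    hsNorm (A * (U : Matrix (Fin d) (Fin d) ℂ)) = hsNorm A := by
  unfold hsNorm
  congr 1
  apply Complex.ofReal_injective
  rw [sum_norm_sq_eq_trace, sum_norm_sq_eq_trace, star_mul, mul_assoc, ← mul_assoc _ (star _),
    Unitary.mul_star_self_of_mem U.2, one_mul]

end HilbertSchmidt

variable {G : Type} [Group G] {d : ℕ} {ρ : UnitaryRep G d}

theorem IsNontrivialRep.dim_pos (hρ : IsNontrivialRep G ρ) : 0 < d := by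
  rcases Nat.eq_zero_or_pos d with rfl | h
  · obtain ⟨a, ha⟩ := hρ
    exact absurd (Subsingleton.elim _ _) ha
  · exact h

variable [Fintype G]

theorem sum_rep_eq_zero (h1 : IsNontrivialRep G ρ) (h2 : IsIrreducibleRep G ρ) :
    ∑ a, (ρ a : Matrix (Fin d) (Fin d) ℂ) = 0 := by
  let W : Submodule ℂ (Fin d → ℂ) :=
    { carrier := {v | ∀ a, (ρ a : Matrix (Fin d) (Fin d) ℂ).mulVec v = v}
      add_mem' := fun hv hw a => by rw [Matrix.mulVec_add, hv a, hw a]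
      zero_mem' := fun a => Matrix.mulVec_zero _
      smul_mem' := fun c v hv a => by rw [Matrix.mulVec_smul, hv a] }
  have hW : ∀ a, ∀ w ∈ W, (ρ a : Matrix (Fin d) (Fin d) ℂ).mulVec w ∈ W := fun a w hw => by
    rw [hw a]
    exact hw
  rcases h2 W hW with hbot | htop
  · refine Matrix.ext_of_mulVec_single fun j => ?_
    rw [Matrix.zero_mulVec]
    refine (Submodule.mem_bot ℂ).1 (hbot ▸ fun b => ?_)
    rw [Matrix.mulVec_mulVec, Finset.mul_sum]
    congr 1
    refine Fintype.sum_equiv (Equiv.mulLeft b) _ _ fun a => ?_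
    simp
  · obtain ⟨a, ha⟩ := h1
    refine absurd (Matrix.ext_of_mulVec_single fun j => ?_) ha
    rw [Matrix.one_mulVec]
    exact (show _ ∈ W by rw [htop]; trivial) a

theorem IsIrreducibleRep.dim_le_card (h2 : IsIrreducibleRep G ρ) (hd : 0 < d) :
    d ≤ Fintype.card G := by
  set v : Fin d → ℂ := Pi.single ⟨0, hd⟩ 1 with hv
  set f : G → Fin d → ℂ := fun a => (ρ a : Matrix (Fin d) (Fin d) ℂ).mulVec v with hf
  have hinv : ∀ a, ∀ w ∈ Submodule.span ℂ (Set.range f),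
      (ρ a : Matrix (Fin d) (Fin d) ℂ).mulVec w ∈ Submodule.span ℂ (Set.range f) := by
    intro a w hw
    induction hw using Submodule.span_induction with
    | mem x hx =>
      obtain ⟨b, rfl⟩ := hx
      refine Submodule.subset_span ⟨a * b, ?_⟩
      simp [hf, Matrix.mulVec_mulVec]
    | zero => simp
    | add x y _ _ hx hy =>
      rw [Matrix.mulVec_add]
      exact add_mem hx hy
    | smul c x _ hx =>
      rw [Matrix.mulVec_smul]
      exact Submodule.smul_mem _ c hx
  have hfin := finrank_range_le_card (R := ℂ) f
  rcases h2 _ hinv with hbot | htop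
  · have hmem : v ∈ Submodule.span ℂ (Set.range f) := Submodule.subset_span ⟨1, by simp [hf]⟩
    rw [hbot, Submodule.mem_bot, hv] at hmem
    simp at hmem
  · rw [Set.finrank, htop, finrank_top, Module.finrank_fin_fun] at hfin
    exact hfin

/-- Right multiplication by a nontrivial irreducible unitary representation, on matrices with
the Hilbert–Schmidt norm. -/
def matrixAction (h1 : IsNontrivialRep G ρ) (h2 : IsIrreducibleRep G ρ) :
    IsometricAction G (PiLp 2 (fun _ : Fin d × Fin d => ℂ)) where
  act a :=
    { toLinearMap := (vecEquiv d).toLinearMap ∘ₗ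
        LinearMap.mulRight ℝ (ρ a : Matrix (Fin d) (Fin d) ℂ) ∘ₗ (vecEquiv d).symm.toLinearMap
      norm_map' := fun x => by
        obtain ⟨A, rfl⟩ := (vecEquiv d).surjective x
        simp [norm_vecEquiv, hsNorm_mul_unitary] }
  act_one x := by simp
  act_mul a b x := by simp [mul_assoc]
  sum_act x := by
    simp [← map_sum, ← Finset.mul_sum, sum_rep_eq_zero h1 h2]

theorem matrixAction_act_vecEquiv (h1 : IsNontrivialRep G ρ) (h2 : IsIrreducibleRep G ρ) (a : G)
    (A : Matrix (Fin d) (Fin d) ℂ) :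
    (matrixAction h1 h2).act a (vecEquiv d A) =
      vecEquiv d (A * (ρ a : Matrix (Fin d) (Fin d) ℂ)) := by
  simp [matrixAction]

theorem sum_nCount_smul {K : Type} [Fintype K] {n : ℕ} {M : Type*} [AddCommGroup M] [Module ℝ M]
    (σ : Config K n) (f : K → M) : ∑ a, (nCount K σ a : ℝ) • f a = ∑ i, f (σ i) := by
  rw [← Finset.sum_fiberwise Finset.univ σ (fun i => f (σ i))]
  refine Finset.sum_congr rfl fun a _ => ?_
  rw [Finset.sum_congr rfl (g := fun _ => f a)
    (fun i hi => by rw [(Finset.mem_filter.1 hi).2]), Finset.sum_const, Nat.cast_smul_eq_nsmul]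
  rfl

theorem vecEquiv_xCoeff (h1 : IsNontrivialRep G ρ) (h2 : IsIrreducibleRep G ρ) {n : ℕ}
    (σ : Config G n) :
    vecEquiv d (xCoeff G ρ σ) = (matrixAction h1 h2).mean (vecEquiv d 1) σ := by
  simp only [IsometricAction.mean, matrixAction_act_vecEquiv, one_mul]
  rw [← sum_nCount_smul σ (fun a => vecEquiv d (ρ a : Matrix (Fin d) (Fin d) ℂ)),
    Finset.smul_sum, xCoeff, map_sum]
  refine Finset.sum_congr rfl fun a _ => ?_
  rw [Complex.coe_smul, map_smul, smul_smul, inv_mul_eq_div]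

theorem norm_vecEquiv_one_sq : ‖vecEquiv d 1‖ ^ 2 = d := by
  rw [norm_vecEquiv, hsNorm, Real.sq_sqrt (by positivity)]
  apply Complex.ofReal_injective
  rw [sum_norm_sq_eq_trace]
  simp

end PR

/-- Lemma 3.2: for any `σ ∈ S_non(1/3)` and any non-trivial irreducible
unitary representation `ρ ∈ G^*`, there is a constant `c_G > 0` depending only on `G` such
that for all large enough `n`,
`Pr_σ(⋃_{t=1}^{n²} {‖x_ρ(σ_t)‖_HS ≥ n^{−1/8} + e^{−c_G t/n} ‖x_ρ(σ_0)‖_HS}) ≤ 1/n³`. -/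
theorem fourier_coefficient_decay
    (G : Type) [Group G] [Fintype G] :
    ∃ c : ℝ, 0 < c ∧ ∃ N : ℕ, ∀ n : ℕ, N ≤ n →
      ∀ (d : ℕ) (ρ : PR.UnitaryRep G d),
        PR.IsNontrivialRep G ρ → PR.IsIrreducibleRep G ρ →
        ∀ σ ∈ PR.SNon G n (1 / 3),
          PR.pathProb G σ (n ^ 2)
            {p | ∃ t : Fin (n ^ 2 + 1), 1 ≤ (t : ℕ) ∧
              (n : ℝ) ^ (-(1 / 8 : ℝ)) +
                  Real.exp (-(c * (t : ℕ)) / n) * PR.hsNorm (PR.xCoeff G ρ σ)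
                ≤ PR.hsNorm (PR.xCoeff G ρ (p t))}
          ≤ 1 / (n : ℝ) ^ 3 := by
  obtain ⟨N, hN⟩ := eventually_atTop.1
    (PR.IsometricAction.eventually_sum_iterate_transition_le G)
  refine ⟨PR.gap G ^ 2 / 12, by have := PR.gap_pos (G := G); positivity, N,
    fun n hn d ρ h1 h2 σ hσ => ?_⟩
  obtain ⟨hn2, hmain⟩ := hN n hn
  have hcard : ‖PR.vecEquiv d 1‖ ^ 2 ≤ Fintype.card G := by
    rw [PR.norm_vecEquiv_one_sq]
    exact_mod_cast h2.dim_le_card h1.dim_pos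
  have h := (PR.pathProb_le_sum hn2 σ (n ^ 2) _).trans
    (hmain _ (PR.matrixAction h1 h2) (PR.vecEquiv d 1) hcard σ hσ)
  simpa only [← PR.vecEquiv_xCoeff, PR.norm_vecEquiv, Set.mem_ofPred_eq] using h
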